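/- Measure zero sets of certifying directions: let n ≥ 2, let g_0, g_1, …, g_m be nonzero polynomials in n real variables with degrees p_i := totalDegree(g_i), and define D* := {d on the unit sphere S^{n−1} ⊆ ℝ^n : for every i ∈ {0,…,m} there exists μ ≥ 1 with φ_{i,μ}(d) < 0 and φ_{i,k}(d) = 0 for all k > μ}. Suppose that for every d ∈ D* there exists an index i ∈ {0,…,m} with φ_{i,p_i}(d) = 0. Then D* has (n−1)-dimensional Hausdorff measure zero: ℋ^{n−1}(D*) = 0. -/

import Mathlib

open MvPolynomial MeasureTheory

open Set Filter Topology

/-- The zero set of a nonzero real polynomial has Lebesgue measure zero. -/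
theorem volume_setOf_eval_eq_zero {n : ℕ} (p : MvPolynomial (Fin n) ℝ) (hp : p ≠ 0) :
    volume {x : Fin n → ℝ | eval x p = 0} = 0 := by
  induction n with
  | zero =>
    have : {x : Fin 0 → ℝ | eval x p = 0} = ∅ := by
      refine eq_empty_of_forall_notMem fun x hx => hp (MvPolynomial.funext fun y => ?_)
      rw [Subsingleton.elim y x, map_zero]
      exact hx
    rw [this, measure_empty]
  | succ n ih =>
    have hq : finSuccEquiv ℝ n p ≠ 0 := by simpa using hp
    have hmeas : MeasurableSet {x : Fin (n + 1) → ℝ | eval x p = 0} :=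
      (isClosed_eq (continuous_eval p) continuous_const).measurableSet
    have hmp := ((volume_preserving_piFinSuccAbove (fun _ : Fin (n + 1) => ℝ) 0).symm _).comp
      (Measure.measurePreserving_swap
        (μ := (volume : Measure (Fin n → ℝ))) (ν := (volume : Measure ℝ)))
    rw [← hmp.measure_preimage hmeas.nullMeasurableSet,
      Measure.measure_prod_null (hmp.measurable hmeas)]
    have hae : ∀ᵐ s : Fin n → ℝ, eval s (finSuccEquiv ℝ n p).leadingCoeff ≠ 0 := by
      rw [ae_iff]
      simpa using ih _ (Polynomial.leadingCoeff_ne_zero.mpr hq)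
    filter_upwards [hae] with s hs
    have hr : Polynomial.map (eval s) (finSuccEquiv ℝ n p) ≠ 0 := by
      intro h
      apply hs
      rw [Polynomial.leadingCoeff, ← Polynomial.coeff_map, h, Polynomial.coeff_zero]
    refine Set.Finite.measure_zero
      ((Polynomial.finite_setOfPred_isRoot hr).subset fun y hy => ?_) _
    have hy' : eval (Fin.cons y s : Fin (n + 1) → ℝ) p = 0 := by
      simpa [MeasurableEquiv.piFinSuccAbove, Fin.insertNthEquiv] using hy
    rwa [eval_eq_eval_mv_eval'] at hy'

theorem MvPolynomial.IsHomogeneous.eval_smul {σ R : Type*} [CommSemiring R]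
    {p : MvPolynomial σ R} {k : ℕ} (hp : p.IsHomogeneous k) (c : R) (x : σ → R) :
    eval (c • x) p = c ^ k * eval x p := by
  rw [eval_eq, eval_eq, Finset.mul_sum]
  refine Finset.sum_congr rfl fun d hd => ?_
  have hd' : ∑ i ∈ d.support, d i = k := by
    simpa [Finsupp.weight_apply, Finsupp.sum] using hp (mem_support_iff.mp hd)
  simp only [Pi.smul_apply, smul_eq_mul, mul_pow, Finset.prod_mul_distrib,
    Finset.prod_pow_eq_pow_sum, hd']
  ring

theorem MvPolynomial.homogeneousComponent_totalDegree_ne_zero {σ R : Type*} [CommSemiring R]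
    {p : MvPolynomial σ R} (hp : p ≠ 0) : homogeneousComponent p.totalDegree p ≠ 0 := by
  obtain ⟨d, hd, hmax⟩ := Finset.exists_mem_eq_sup p.support (support_nonempty.mpr hp)
    fun s => s.sum fun _ e => e
  intro h
  apply mem_support_iff.mp hd
  have hc := congrArg (coeff d) h
  rwa [coeff_homogeneousComponent, if_pos, coeff_zero] at hc
  rw [totalDegree, hmax]
  rfl

/-- A nonzero homogeneous polynomial restricts to a nonzero polynomial on each affine hyperplane
`x j = 1`, so its zeros there form a null set. -/
theorem MvPolynomial.IsHomogeneous.volume_setOf_eval_insertNth_eq_zero {n k : ℕ}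
    {p : MvPolynomial (Fin (n + 1)) ℝ} (hp : p.IsHomogeneous k) (hp0 : p ≠ 0) (j : Fin (n + 1)) :
    volume {y : Fin n → ℝ | eval (j.insertNth 1 y : Fin (n + 1) → ℝ) p = 0} = 0 := by
  have heval (y : Fin n → ℝ) :
      eval y (MvPolynomial.aeval (j.insertNth 1 X : Fin (n + 1) → MvPolynomial (Fin n) ℝ) p) =
        eval (j.insertNth 1 y : Fin (n + 1) → ℝ) p := by
    rw [← coe_aeval_eq_eval, ← coe_aeval_eq_eval]
    change ((MvPolynomial.aeval y).comp (MvPolynomial.aeval _)) p = MvPolynomial.aeval _ p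
    congr 1
    ext i
    induction i using j.succAboveCases <;> simp
  simp_rw [← heval]
  refine volume_setOf_eval_eq_zero _ fun h0 => ?_
  have hmul : X j * p = 0 := by
    refine MvPolynomial.funext fun x => ?_
    rw [map_mul, eval_X, map_zero]
    by_cases hx : x j = 0
    · rw [hx, zero_mul]
    · have hxs : x = x j • (j.insertNth 1 (fun i => x (j.succAbove i) / x j) :
          Fin (n + 1) → ℝ) := by
        ext i
        induction i using j.succAboveCases <;> simp
        field_simp
      rw [hxs, hp.eval_smul, ← heval, h0, map_zero, mul_zero, mul_zero]
  exact (mul_ne_zero (X_ne_zero j) hp0) hmul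

/-- A locally Lipschitz map sends `μH[d]`-null sets to `μH[d]`-null sets. -/
theorem LocallyLipschitz.hausdorffMeasure_image_eq_zero {E F : Type*}
    [EMetricSpace E] [SecondCountableTopology E] [MeasurableSpace E] [BorelSpace E]
    [EMetricSpace F] [MeasurableSpace F] [BorelSpace F]
    {f : E → F} (hf : LocallyLipschitz f) {d : ℝ} (hd : 0 ≤ d) {s : Set E} (hs : μH[d] s = 0) :
    μH[d] (f '' s) = 0 := by
  choose K t ht hL using hf
  obtain ⟨c, hc, hcover⟩ := TopologicalSpace.countable_cover_nhds ht
  have hsub : f '' s ⊆ ⋃ x ∈ c, f '' (t x ∩ s) := by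
    rintro _ ⟨x, hx, rfl⟩
    obtain ⟨y, hy, hxy⟩ := mem_iUnion₂.mp (hcover ▸ mem_univ x)
    exact mem_iUnion₂.mpr ⟨y, hy, mem_image_of_mem f ⟨hxy, hx⟩⟩
  refine measure_mono_null hsub ((measure_biUnion_null_iff hc).mpr fun x _ => ?_)
  refine le_antisymm ?_ zero_le
  calc μH[d] (f '' (t x ∩ s)) ≤ (K x : ENNReal) ^ d * μH[d] (t x ∩ s) :=
        ((hL x).mono inter_subset_left).hausdorffMeasure_image_le hd
    _ = 0 := by rw [measure_mono_null inter_subset_right hs, mul_zero]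

/-- The zeros on the unit sphere of a nonzero homogeneous polynomial form a null set for the
Hausdorff measure of codimension one. -/
theorem MvPolynomial.IsHomogeneous.hausdorffMeasure_sphere_zeros {n k : ℕ}
    {p : MvPolynomial (Fin (n + 1)) ℝ} (hp : p.IsHomogeneous k) (hp0 : p ≠ 0) :
    μH[n] {d : EuclideanSpace ℝ (Fin (n + 1)) | ‖d‖ = 1 ∧ eval (d : Fin (n + 1) → ℝ) p = 0} =
      0 := by
  let v (j : Fin (n + 1)) (y : Fin n → ℝ) : EuclideanSpace ℝ (Fin (n + 1)) :=
    WithLp.toLp 2 (j.insertNth 1 y)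
  have hv0 (j y) : v j y ≠ 0 := fun h => by
    have := congrArg (fun w : EuclideanSpace ℝ (Fin (n + 1)) => w j) h
    simp [v] at this
  have hv (j) : ContDiff ℝ 1 (v j) := by
    rw [contDiff_euclidean]
    intro i
    induction i using j.succAboveCases with
    | x => simpa [v] using contDiff_const
    | p i => simpa [v] using contDiff_apply ℝ ℝ i
  let F (j : Fin (n + 1)) (c : ℝ) (y : Fin n → ℝ) : EuclideanSpace ℝ (Fin (n + 1)) :=
    (c * ‖v j y‖⁻¹) • v j y
  have hF (j c) : LocallyLipschitz (F j c) :=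
    ((contDiff_const.mul (((hv j).norm ℝ (hv0 j)).inv
      fun y => norm_ne_zero_iff.mpr (hv0 j y))).smul (hv j)).locallyLipschitz
  let Z (j : Fin (n + 1)) : Set (Fin n → ℝ) :=
    {y | eval (j.insertNth 1 y : Fin (n + 1) → ℝ) p = 0}
  have hZ (j) : μH[n] (Z j) = 0 := by
    have := hp.volume_setOf_eval_insertNth_eq_zero hp0 j
    rwa [← hausdorffMeasure_pi_real, Fintype.card_fin] at this
  have hnull (j c) : μH[n] (F j c '' Z j) = 0 :=
    (hF j c).hausdorffMeasure_image_eq_zero n.cast_nonneg (hZ j)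
  refine measure_mono_null (t := ⋃ j, (F j 1 '' Z j ∪ F j (-1) '' Z j)) ?_
    (measure_iUnion_null fun j => measure_union_null (hnull j 1) (hnull j (-1)))
  rintro d ⟨hd1, hdp⟩
  obtain ⟨j, hj⟩ : ∃ j, d j ≠ 0 := by
    by_contra! h
    have : d = 0 := by ext i; exact h i
    simp [this] at hd1
  let y : Fin n → ℝ := fun i => d (j.succAbove i) / d j
  have hdv : d = d j • v j y := by
    ext i
    induction i using j.succAboveCases <;> simp [v, y]
    field_simp
  have hy : y ∈ Z j := by
    have h : eval (d j • (j.insertNth 1 y : Fin (n + 1) → ℝ)) p = 0 := by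
      have : (d : Fin (n + 1) → ℝ) = d j • (j.insertNth 1 y : Fin (n + 1) → ℝ) :=
        congrArg WithLp.ofLp hdv
      rw [← this]
      exact hdp
    rw [hp.eval_smul] at h
    exact (mul_eq_zero.mp h).resolve_left (pow_ne_zero _ hj)
  have hnorm : |d j| = ‖v j y‖⁻¹ := by
    refine eq_inv_of_mul_eq_one_left ?_
    rw [← Real.norm_eq_abs, ← norm_smul, ← hdv, hd1]
  refine mem_iUnion.mpr ⟨j, ?_⟩
  rcases abs_choice (d j) with h | h
  · refine Or.inl ⟨y, hy, ?_⟩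
    rw [hdv]
    simp only [F]
    rw [one_mul, ← hnorm, h]
  · refine Or.inr ⟨y, hy, ?_⟩
    simp only [F]
    rw [← hnorm, h, neg_one_mul, neg_neg, ← hdv]

theorem stmt_16 (n m : ℕ) (hn : 2 ≤ n) (g : Fin (m + 1) → MvPolynomial (Fin n) ℝ)
    (hg : ∀ i, g i ≠ 0)
    (Dstar : Set (EuclideanSpace ℝ (Fin n)))
    (hDstar : Dstar = {d : EuclideanSpace ℝ (Fin n) | ‖d‖ = 1 ∧
      ∀ i : Fin (m + 1), ∃ μ : ℕ, 1 ≤ μ ∧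
        MvPolynomial.eval (d : Fin n → ℝ) (MvPolynomial.homogeneousComponent μ (g i)) < 0 ∧
        ∀ k, μ < k →
          MvPolynomial.eval (d : Fin n → ℝ) (MvPolynomial.homogeneousComponent k (g i)) = 0})
    (hdeg : ∀ d ∈ Dstar, ∃ i : Fin (m + 1),
      MvPolynomial.eval (d : Fin n → ℝ)
        (MvPolynomial.homogeneousComponent (g i).totalDegree (g i)) = 0) :
    μH[(n : ℝ) - 1] Dstar = 0 := by
  obtain ⟨k, rfl⟩ : ∃ k, n = k + 1 := ⟨n - 1, by omega⟩
  have hk : ((k + 1 : ℕ) : ℝ) - 1 = k := by push_cast; ring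
  rw [hk]
  refine measure_mono_null (fun d hd => ?_) (measure_iUnion_null fun i =>
    (homogeneousComponent_isHomogeneous (g i).totalDegree (g i)).hausdorffMeasure_sphere_zeros
      (homogeneousComponent_totalDegree_ne_zero (hg i)))
  obtain ⟨i, hi⟩ := hdeg d hd
  rw [hDstar] at hd
  exact mem_iUnion.mpr ⟨i, hd.1, hi⟩
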